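/- Fix n, l ∈ ℕ with n > l ≥ 1. Equip ℂ[z₁,z₂] with the hermitian inner product determined by declaring distinct monomials orthogonal and ⟨z₁^a z₂^b, z₁^a z₂^b⟩ = a!·b!, and equip P_n ⊗ P_l with the induced product inner product. Let h = Σ_{k=0}^{l} (−1)^k binom(l,k) z₂^k z₁^{n−k} ⊗ z₁^k z₂^{l−k}, let v = (X₋⊗1 + 1⊗X₋)h where X₋ = z₂∂₁, and let X₃ = ½(z₁∂₁ − z₂∂₂). Then ⟨v, (X₃⊗1)v⟩ / ⟨h, h⟩ = (n+2)(n−l−2)(n−l) / (2(n−l+2)). -/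

import Mathlib

open MvPolynomial

/-- Multiplication by the variable `zᵢ` ("creation operator" `aᵢ† = zᵢ`). -/
noncomputable def mulZ (i : Fin 2) : Module.End ℂ (MvPolynomial (Fin 2) ℂ) :=
  LinearMap.mulLeft ℂ (X i)

/-- The su(2) generators `X₁ = ½(z₁∂₂ + z₂∂₁)`, `X₂ = −(i/2)(z₁∂₂ − z₂∂₁)`,
`X₃ = ½(z₁∂₁ − z₂∂₂)` acting on `ℂ[z₁,z₂]` (variables indexed by `0, 1`,
operators indexed by `0, 1, 2`). -/
noncomputable def Xop : Fin 3 → Module.End ℂ (MvPolynomial (Fin 2) ℂ)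
  | 0 => ((1:ℂ)/2) • (mulZ 0 ∘ₗ (pderiv (R := ℂ) (1 : Fin 2)).toLinearMap
            + mulZ 1 ∘ₗ (pderiv (R := ℂ) (0 : Fin 2)).toLinearMap)
  | 1 => (-Complex.I/2) • (mulZ 0 ∘ₗ (pderiv (R := ℂ) (1 : Fin 2)).toLinearMap
            - mulZ 1 ∘ₗ (pderiv (R := ℂ) (0 : Fin 2)).toLinearMap)
  | 2 => ((1:ℂ)/2) • (mulZ 0 ∘ₗ (pderiv (R := ℂ) (0 : Fin 2)).toLinearMap
            - mulZ 1 ∘ₗ (pderiv (R := ℂ) (1 : Fin 2)).toLinearMap)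

/-- The totally antisymmetric Levi-Civita symbol `ε_{abc}` on `{0,1,2}` with `ε₀₁₂ = 1`. -/
noncomputable def eps (a b c : Fin 3) : ℂ :=
  (((b : ℤ) - (a : ℤ)) * ((c : ℤ) - (a : ℤ)) * ((c : ℤ) - (b : ℤ)) : ℂ) / 2


open TensorProduct

/-- The identity operator on `ℂ[z₁,z₂]`. -/
noncomputable def idP : Module.End ℂ (MvPolynomial (Fin 2) ℂ) := LinearMap.id

/-- The Bargmann hermitian inner product on a polynomial ring over `ℂ`: distinct monomials
are orthogonal and `⟨∏ zᵢ^{aᵢ}, ∏ zᵢ^{aᵢ}⟩ = ∏ aᵢ!` (conjugate-linear in the first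
argument). -/
noncomputable def binner {σ : Type*} (p q : MvPolynomial σ ℂ) : ℂ :=
  ∑ m ∈ p.support,
    (starRingEnd ℂ) (p.coeff m) * q.coeff m * (m.prod fun _ k => (k.factorial : ℂ))

/-- The canonical identification of `ℂ[z₁,z₂] ⊗ ℂ[z₁,z₂]` with the polynomial ring in two
pairs of variables, sending `p ⊗ q` to `p(z_left)·q(z_right)`. -/
noncomputable def phi :
    (MvPolynomial (Fin 2) ℂ ⊗[ℂ] MvPolynomial (Fin 2) ℂ) →ₐ[ℂ] MvPolynomial (Fin 2 ⊕ Fin 2) ℂ :=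
  Algebra.TensorProduct.productMap (rename Sum.inl) (rename Sum.inr)

/-- The induced product inner product on `ℂ[z₁,z₂] ⊗ ℂ[z₁,z₂]`: on pure tensors,
`⟨p₁ ⊗ p₂, q₁ ⊗ q₂⟩ = ⟨p₁,q₁⟩·⟨p₂,q₂⟩` for the Bargmann inner products of the factors. -/
noncomputable def tinner (x y : MvPolynomial (Fin 2) ℂ ⊗[ℂ] MvPolynomial (Fin 2) ℂ) : ℂ :=
  binner (phi x) (phi y)

/-- The Bargmann product of two combinations of the same distinct monomials. -/
theorem binner_sum_monomial {σ ι : Type*} (s : Finset ι) (e : ι → σ →₀ ℕ)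
    (he : Set.InjOn e s) (c d : ι → ℂ) :
    binner (∑ k ∈ s, monomial (e k) (c k)) (∑ k ∈ s, monomial (e k) (d k)) =
      ∑ k ∈ s, (starRingEnd ℂ) (c k) * d k * ((e k).prod fun _ j => (j.factorial : ℂ)) := by
  classical
  have coeff_sum_monomial (c : ι → ℂ) {k : ι} (hk : k ∈ s) :
      coeff (e k) (∑ j ∈ s, monomial (e j) (c j)) = c k := by
    rw [coeff_sum, Finset.sum_eq_single_of_mem k hk, coeff_monomial, if_pos rfl]
    intro j hj hjk
    rw [coeff_monomial, if_neg fun h => hjk (he hj hk h)]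
  have hsupp : (∑ k ∈ s, monomial (e k) (c k)).support ⊆ s.image e := by
    refine support_sum.trans (Finset.biUnion_subset.mpr fun k hk => ?_)
    exact support_monomial_subset.trans
      (Finset.singleton_subset_iff.mpr (Finset.mem_image_of_mem e hk))
  rw [binner, Finset.sum_subset hsupp, Finset.sum_image he]
  · refine Finset.sum_congr rfl fun k hk => ?_
    rw [coeff_sum_monomial c hk, coeff_sum_monomial d hk]
  · intro m _ hm
    rw [notMem_support_iff.mp hm, map_zero, zero_mul, zero_mul]

/-- The exponent of `z₁^a z₂^b ⊗ z₁^c z₂^d` in the two pairs of variables. -/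
noncomputable def pairExponent (a b c d : ℕ) : Fin 2 ⊕ Fin 2 →₀ ℕ :=
  Finsupp.single (Sum.inl 0) a + Finsupp.single (Sum.inl 1) b +
    Finsupp.single (Sum.inr 0) c + Finsupp.single (Sum.inr 1) d

theorem pairExponent_inr_zero (a b c d : ℕ) : pairExponent a b c d (Sum.inr 0) = c := by
  simp [pairExponent]

theorem prod_factorial_pairExponent (a b c d : ℕ) :
    ((pairExponent a b c d).prod fun _ k => (k.factorial : ℂ)) =
      a.factorial * b.factorial * (c.factorial * d.factorial) := by
  rw [Finsupp.prod_fintype _ _ (by simp)]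
  simp [pairExponent, Fintype.prod_sum_type, Fin.prod_univ_two]

theorem phi_smul_tmul (r : ℂ) (a b c d : ℕ) :
    phi (r • ((X 1 ^ b * X 0 ^ a) ⊗ₜ[ℂ] (X 0 ^ c * X 1 ^ d))) =
      monomial (pairExponent a b c d) r := by
  rw [map_smul, phi, Algebra.TensorProduct.productMap_apply_tmul]
  simp only [map_mul, map_pow, rename_X]
  simp only [X_pow_eq_monomial, monomial_mul, smul_monomial, smul_eq_mul, mul_one, pairExponent]
  congr 2
  abel

/-- The product of two combinations of the tensors `z₂^(k+s) z₁^(a k) ⊗ z₁^k z₂^(b k)`. -/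
theorem tinner_sum (l s : ℕ) (a b : ℕ → ℕ) (c d : ℕ → ℂ) :
    tinner
      (∑ k ∈ Finset.range (l + 1), c k • ((X 1 ^ (k + s) * X 0 ^ a k) ⊗ₜ[ℂ] (X 0 ^ k * X 1 ^ b k)))
      (∑ k ∈ Finset.range (l + 1), d k • ((X 1 ^ (k + s) * X 0 ^ a k) ⊗ₜ[ℂ] (X 0 ^ k * X 1 ^ b k)))
      = ∑ k ∈ Finset.range (l + 1), (starRingEnd ℂ) (c k) * d k *
          ((a k).factorial * (k + s).factorial * (k.factorial * (b k).factorial)) := by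
  simp only [tinner, map_sum, phi_smul_tmul]
  rw [binner_sum_monomial]
  · simp only [prod_factorial_pairExponent]
  · intro j _ k _ hjk
    simpa only [pairExponent_inr_zero] using DFunLike.congr_fun hjk (Sum.inr 0)

theorem lowering_pow_mul_pow (a b : ℕ) :
    (mulZ 1 ∘ₗ (pderiv (R := ℂ) (0 : Fin 2)).toLinearMap) (X 1 ^ b * X 0 ^ a) =
      (a : ℂ) • (X 1 ^ (b + 1) * X 0 ^ (a - 1)) := by
  simp [mulZ, Derivation.leibniz, Derivation.leibniz_pow, pderiv_X, smul_eq_C_mul]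
  ring

theorem Xop_two_pow_mul_pow (a b : ℕ) :
    Xop 2 (X 1 ^ b * X 0 ^ a) = (((a : ℂ) - b) / 2) • (X 1 ^ b * X 0 ^ a) := by
  have h (x : MvPolynomial (Fin 2) ℂ) (m : ℕ) : x * (m * x ^ (m - 1)) = m * x ^ m := by
    cases m with
    | zero => simp
    | succ m => rw [Nat.add_sub_cancel, pow_succ]; ring
  have h0 : (mulZ 0 ∘ₗ (pderiv (R := ℂ) (0 : Fin 2)).toLinearMap) (X 1 ^ b * X 0 ^ a) =
      (a : ℂ) • (X 1 ^ b * X 0 ^ a) := by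
    simp [mulZ, Derivation.leibniz, Derivation.leibniz_pow, pderiv_X, smul_eq_C_mul]
    linear_combination X 1 ^ b * h (X 0) a
  have h1 : (mulZ 1 ∘ₗ (pderiv (R := ℂ) (1 : Fin 2)).toLinearMap) (X 1 ^ b * X 0 ^ a) =
      (b : ℂ) • (X 1 ^ b * X 0 ^ a) := by
    simp [mulZ, Derivation.leibniz, Derivation.leibniz_pow, pderiv_X, smul_eq_C_mul]
    linear_combination X 0 ^ a * h (X 1) b
  rw [Xop, LinearMap.smul_apply, LinearMap.sub_apply, h0, h1, ← sub_smul, smul_smul]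
  congr 1
  ring

/-- The total lowering operator applied to the highest weight vector of `[N − ν] ⊆ [N] ⊗ [ν]`. -/
theorem lowering_highestWeight (n l : ℕ) (hnl : l < n)
    (Xminus : Module.End ℂ (MvPolynomial (Fin 2) ℂ))
    (hX : Xminus = mulZ 1 ∘ₗ (pderiv (R := ℂ) (0 : Fin 2)).toLinearMap) :
    (TensorProduct.map Xminus idP + TensorProduct.map idP Xminus)
      (∑ k ∈ Finset.range (l + 1), ((-1 : ℂ) ^ k * (Nat.choose l k : ℂ)) •
        ((X 1 ^ k * X 0 ^ (n - k)) ⊗ₜ[ℂ] (X 0 ^ k * X 1 ^ (l - k)))) =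
    ∑ k ∈ Finset.range (l + 1), (((n : ℂ) - l) * ((-1 : ℂ) ^ k * (Nat.choose l k : ℂ))) •
        ((X 1 ^ (k + 1) * X 0 ^ (n - k - 1)) ⊗ₜ[ℂ] (X 0 ^ k * X 1 ^ (l - k))) := by
  subst hX
  have hright (a b : ℕ) : (mulZ 1 ∘ₗ (pderiv (R := ℂ) (0 : Fin 2)).toLinearMap)
      (X 0 ^ a * X 1 ^ b) = (a : ℂ) • (X 0 ^ (a - 1) * X 1 ^ (b + 1)) := by
    rw [mul_comm, lowering_pow_mul_pow, mul_comm]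
  simp only [LinearMap.add_apply, map_sum, map_smul, TensorProduct.map_tmul, hright,
    lowering_pow_mul_pow]
  simp only [idP, LinearMap.id_apply, ← TensorProduct.smul_tmul', TensorProduct.tmul_smul,
    smul_add, smul_smul, Finset.sum_add_distrib]
  rw [Finset.sum_range_succ' (n := l) (f := fun k => ((-1 : ℂ) ^ k * (Nat.choose l k : ℂ) * k) •
    ((X 1 ^ k * X 0 ^ (n - k)) ⊗ₜ[ℂ] (X 0 ^ (k - 1) * X 1 ^ (l - k + 1)) :
      MvPolynomial (Fin 2) ℂ ⊗[ℂ] MvPolynomial (Fin 2) ℂ))]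
  simp only [Nat.cast_zero, mul_zero, zero_smul, add_zero]
  have hshift : ∀ k ∈ Finset.range l,
      ((-1 : ℂ) ^ (k + 1) * (Nat.choose l (k + 1) : ℂ) * ((k + 1 : ℕ) : ℂ)) •
        ((X 1 ^ (k + 1) * X 0 ^ (n - (k + 1))) ⊗ₜ[ℂ]
          (X 0 ^ (k + 1 - 1) * X 1 ^ (l - (k + 1) + 1)) :
            MvPolynomial (Fin 2) ℂ ⊗[ℂ] MvPolynomial (Fin 2) ℂ) =
      ((-1 : ℂ) ^ k * (Nat.choose l k : ℂ) * ((k : ℂ) - l)) •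
        ((X 1 ^ (k + 1) * X 0 ^ (n - k - 1)) ⊗ₜ[ℂ] (X 0 ^ k * X 1 ^ (l - k))) := by
    intro k hk
    have hkl := Finset.mem_range.mp hk
    rw [show l - (k + 1) + 1 = l - k by omega, Nat.add_sub_cancel, Nat.sub_sub]
    congr 1
    have hc : (Nat.choose l (k + 1) : ℂ) * ((k + 1 : ℕ) : ℂ) = Nat.choose l k * ((l : ℂ) - k) := by
      rw [← Nat.cast_sub hkl.le]
      exact_mod_cast Nat.choose_succ_right_eq l k
    linear_combination (-1 : ℂ) ^ (k + 1) * hc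
  rw [Finset.sum_congr rfl hshift]
  have htop := Finset.sum_range_succ (fun k => ((-1 : ℂ) ^ k * (Nat.choose l k : ℂ) *
    ((k : ℂ) - l)) • ((X 1 ^ (k + 1) * X 0 ^ (n - k - 1)) ⊗ₜ[ℂ] (X 0 ^ k * X 1 ^ (l - k)) :
      MvPolynomial (Fin 2) ℂ ⊗[ℂ] MvPolynomial (Fin 2) ℂ)) l
  rw [sub_self, mul_zero, zero_smul, add_zero] at htop
  rw [← htop, ← Finset.sum_add_distrib]
  refine Finset.sum_congr rfl fun k hk => ?_
  have hkl := Finset.mem_range.mp hk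
  rw [← add_smul, Nat.cast_sub (by omega)]
  congr 1
  ring

theorem sum_factorial_div_factorial_mul (D m : ℕ) (a b c : ℂ) :
    ∑ i ∈ Finset.range (m + 1), ((D + i).factorial : ℂ) / i.factorial *
        (a + b * i + c * (i * (i - 1))) =
      ((D + m + 1).factorial : ℂ) / m.factorial *
        (a / (D + 1) + b * m / (D + 2) + c * (m * (m - 1)) / (D + 3)) := by
  have h1 : (D : ℂ) + 1 ≠ 0 := by exact_mod_cast (D.succ_ne_zero)
  have h2 : (D : ℂ) + 2 ≠ 0 := by exact_mod_cast (D + 1).succ_ne_zero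
  have h3 : (D : ℂ) + 3 ≠ 0 := by exact_mod_cast (D + 2).succ_ne_zero
  induction m with
  | zero =>
    simp only [zero_add, Finset.sum_range_one, add_zero, Nat.factorial_succ]
    push_cast
    field_simp
    simp
    ring
  | succ m ih =>
    have hm : (m : ℂ) + 1 ≠ 0 := by exact_mod_cast m.succ_ne_zero
    have hf : (m.factorial : ℂ) ≠ 0 := by exact_mod_cast m.factorial_ne_zero
    rw [Finset.sum_range_succ, ih, ← add_assoc, Nat.factorial_succ (D + m + 1),
      Nat.factorial_succ m]
    push_cast
    field_simp
    ring

theorem choose_sq_mul_factorial (l k : ℕ) (hk : k ≤ l) :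
    (Nat.choose l k : ℂ) ^ 2 * k.factorial ^ 2 * (l - k).factorial =
      (l.factorial : ℂ) ^ 2 / (l - k).factorial := by
  have hf : ((l - k).factorial : ℂ) ≠ 0 := by exact_mod_cast (l - k).factorial_ne_zero
  have h : (Nat.choose l k : ℂ) * k.factorial * (l - k).factorial = l.factorial := by
    exact_mod_cast Nat.choose_mul_factorial_mul_factorial hk
  rw [← h]
  field_simp

/-- For `h = Σ_{k=0}^{l} (−1)^k C(l,k) z₂^k z₁^{n−k} ⊗ z₁^k z₂^{l−k}` (with `n > l ≥ 1`),
`v = (X₋⊗1 + 1⊗X₋)h` with `X₋ = z₂∂₁`, and `X₃ = ½(z₁∂₁ − z₂∂₂)`, one has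
`⟨v,(X₃⊗1)v⟩/⟨h,h⟩ = (n+2)(n−l−2)(n−l)/(2(n−l+2))`. -/
theorem vXv_bottom (n l : ℕ) (hl : 1 ≤ l) (hnl : l < n) :
    ∀ Xthree Xminus : Module.End ℂ (MvPolynomial (Fin 2) ℂ),
      Xthree = Xop 2 →
      Xminus = mulZ 1 ∘ₗ (pderiv (R := ℂ) (0 : Fin 2)).toLinearMap →
    ∀ h v : MvPolynomial (Fin 2) ℂ ⊗[ℂ] MvPolynomial (Fin 2) ℂ,
      h = ∑ k ∈ Finset.range (l + 1),
            ((-1 : ℂ) ^ k * (Nat.choose l k : ℂ)) •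
              ((X 1 ^ k * X 0 ^ (n - k)) ⊗ₜ[ℂ] (X 0 ^ k * X 1 ^ (l - k))) →
      v = (TensorProduct.map Xminus idP + TensorProduct.map idP Xminus) h →
      tinner v (TensorProduct.map Xthree idP v) / tinner h h
        = ((n : ℂ) + 2) * ((n : ℂ) - (l : ℂ) - 2) * ((n : ℂ) - (l : ℂ)) /
            (2 * ((n : ℂ) - (l : ℂ) + 2)) := by
  rintro Xthree Xminus hthree hminus h v rfl rfl
  obtain ⟨D, rfl⟩ : ∃ D, n = l + D + 1 := ⟨n - l - 1, by omega⟩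
  have hconj (k : ℕ) : (starRingEnd ℂ) ((-1) ^ k * (Nat.choose l k : ℂ)) *
      ((-1) ^ k * (Nat.choose l k : ℂ)) = (Nat.choose l k : ℂ) ^ 2 := by
    have hs : ((-1 : ℂ) ^ k) ^ 2 = 1 := by rw [← pow_mul, mul_comm, pow_mul]; simp
    simp only [map_mul, map_pow, map_neg, map_one, map_natCast]
    linear_combination (Nat.choose l k : ℂ) ^ 2 * hs
  have hnorm := tinner_sum l 0 (fun k => l + D + 1 - k) (fun k => l - k)
    (fun k => (-1) ^ k * (Nat.choose l k : ℂ)) (fun k => (-1) ^ k * (Nat.choose l k : ℂ))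
  have hval := tinner_sum l 1 (fun k => l + D + 1 - k - 1) (fun k => l - k)
    (fun k => (((l + D + 1 : ℕ) : ℂ) - l) * ((-1) ^ k * (Nat.choose l k : ℂ)))
    (fun k => (((l + D + 1 : ℕ) : ℂ) - l) * ((-1) ^ k * (Nat.choose l k : ℂ)) *
      ((((l + D + 1 - k - 1 : ℕ) : ℂ) - (k + 1 : ℕ)) / 2))
  simp only [add_zero] at hnorm
  rw [lowering_highestWeight _ l (by omega) Xminus hminus, hnorm, hthree]
  simp only [map_sum, map_smul, TensorProduct.map_tmul, Xop_two_pow_mul_pow, idP,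
    LinearMap.id_apply, ← TensorProduct.smul_tmul', smul_smul]
  rw [hval]
  have hN : ∑ k ∈ Finset.range (l + 1), (starRingEnd ℂ) ((-1) ^ k * (Nat.choose l k : ℂ)) *
      ((-1) ^ k * (Nat.choose l k : ℂ)) * ((l + D + 1 - k).factorial * k.factorial *
        (k.factorial * (l - k).factorial)) =
      (l.factorial : ℂ) ^ 2 * (((D + 1 + l + 1).factorial : ℂ) / l.factorial / (D + 2)) := by
    have hsum := sum_factorial_div_factorial_mul (D + 1) l 1 0 0
    rw [← Finset.sum_range_reflect] at hsum
    calc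
      _ = (l.factorial : ℂ) ^ 2 * ∑ k ∈ Finset.range (l + 1), _ := ?_
      _ = _ := congrArg _ hsum
      _ = _ := ?_
    · rw [Finset.mul_sum]
      refine Finset.sum_congr rfl fun k hk => ?_
      have hkl : k ≤ l := Finset.mem_range_succ_iff.mp hk
      rw [hconj, show l + 1 - 1 - k = l - k by omega, show l + D + 1 - k = D + 1 + (l - k) by omega]
      linear_combination ((D + 1 + (l - k)).factorial : ℂ) * choose_sq_mul_factorial l k hkl
    · push_cast
      ring
  have hV : ∑ k ∈ Finset.range (l + 1),
      (starRingEnd ℂ) ((((l + D + 1 : ℕ) : ℂ) - l) * ((-1) ^ k * (Nat.choose l k : ℂ))) *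
      ((((l + D + 1 : ℕ) : ℂ) - l) * ((-1) ^ k * (Nat.choose l k : ℂ)) *
        ((((l + D + 1 - k - 1 : ℕ) : ℂ) - (k + 1 : ℕ)) / 2)) *
      ((l + D + 1 - k - 1).factorial * (k + 1).factorial *
        (k.factorial * (l - k).factorial)) =
      ((D : ℂ) + 1) ^ 2 / 2 * (l.factorial : ℂ) ^ 2 *
        (((D + l + 1).factorial : ℂ) / l.factorial *
          (((l : ℂ) + 1) * (D - 1 - l) / (D + 1) + (3 * l + 1 - D) * l / (D + 2) +
            (-2) * (l * (l - 1)) / (D + 3))) := by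
    have hsum := sum_factorial_div_factorial_mul D l (((l : ℂ) + 1) * (D - 1 - l))
      (3 * l + 1 - D) (-2)
    rw [← Finset.sum_range_reflect] at hsum
    rw [← hsum, Finset.mul_sum]
    refine Finset.sum_congr rfl fun k hk => ?_
    have hkl : k ≤ l := Finset.mem_range_succ_iff.mp hk
    rw [show l + 1 - 1 - k = l - k by omega, show l + D + 1 - k - 1 = D + (l - k) by omega,
      Nat.factorial_succ k, map_mul, map_sub, map_natCast, map_natCast]
    have hw := choose_sq_mul_factorial l k hkl
    rw [← hconj] at hw
    push_cast [Nat.cast_sub hkl]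
    linear_combination ((D : ℂ) + 1) ^ 2 / 2 * (k + 1) * (D + l - 2 * k - 1) *
      (D + (l - k)).factorial * hw
  simp only [Nat.cast_add] at hN hV ⊢
  rw [hN, hV, show D + 1 + l + 1 = (D + l + 1) + 1 by ring, Nat.factorial_succ (D + l + 1)]
  have hfl : (l.factorial : ℂ) ≠ 0 := by exact_mod_cast l.factorial_ne_zero
  have hfD : ((D + l + 1).factorial : ℂ) ≠ 0 := by exact_mod_cast (D + l + 1).factorial_ne_zero
  have h1 : (D : ℂ) + 1 ≠ 0 := by exact_mod_cast D.succ_ne_zero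
  have h2 : (D : ℂ) + 2 ≠ 0 := by exact_mod_cast (D + 1).succ_ne_zero
  have h3 : (D : ℂ) + 3 ≠ 0 := by exact_mod_cast (D + 2).succ_ne_zero
  have h4 : (D : ℂ) + l + 2 ≠ 0 := by exact_mod_cast (D + l + 1).succ_ne_zero
  have h5 : (l : ℂ) + D + 1 - l + 2 = D + 3 := by ring
  push_cast
  rw [h5, show (D : ℂ) + l + 1 + 1 = D + l + 2 by ring]
  field_simp
  ring
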